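/- Let T be a tree on n vertices with T ≠ P_n. Then ξ^ac(T) > ξ^ac(P_n). -/

import Mathlib

open Finset SimpleGraph

/-- Degree of a vertex `u`: the number of neighbors of `u`. -/
noncomputable def deg {V : Type*} [Fintype V] (G : SimpleGraph V) (u : V) : ℕ :=
  {v | G.Adj u v}.ncard

/-- `M(u)`: the product of degrees of all neighbors of `u`. -/
noncomputable def Mprod {V : Type*} [Fintype V] (G : SimpleGraph V) (u : V) : ℕ :=
  ∏ᶠ v ∈ {v | G.Adj u v}, deg G v

/-- Eccentricity of a vertex `u`: the maximum distance from `u` to any vertex. -/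
noncomputable def ecc {V : Type*} [Fintype V] (G : SimpleGraph V) (u : V) : ℕ :=
  Finset.univ.sup fun v => G.dist u v

/-- Diameter of a graph: the maximum distance between two vertices. -/
noncomputable def gdiam {V : Type*} [Fintype V] (G : SimpleGraph V) : ℕ :=
  Finset.univ.sup fun u => ecc G u

/-- The augmented eccentric connectivity index `ξ^{ac}(G) = ∑_u M(u)/ε(u)`. -/
noncomputable def xiAC {V : Type*} [Fintype V] (G : SimpleGraph V) : ℝ :=
  ∑ u : V, (Mprod G u : ℝ) / (ecc G u : ℝ)

/-- The product of the degrees of the neighbors of the `i`-th vertex of a path of length `d ≥ 3`. -/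
def pathWeight (d i : ℕ) : ℕ := if i ≤ 1 ∨ d ≤ i + 1 then 2 else 4

/-- The augmented eccentric connectivity index of a path of length `d ≥ 3`. -/
noncomputable def pathIndex (d : ℕ) : ℝ :=
  ∑ i ∈ range (d + 1), (pathWeight d i : ℝ) / (max i (d - i) : ℕ)

/-- The sum of the reciprocals of the eccentricities of a path of length `d`. -/
noncomputable def pathInvEccSum (d : ℕ) : ℝ :=
  ∑ i ∈ range (d + 1), 1 / ((max i (d - i) : ℕ) : ℝ)

/-- The `n`-th harmonic number, as a real number. -/
noncomputable def realHarmonic (n : ℕ) : ℝ := ∑ i ∈ range n, 1 / ((i : ℝ) + 1)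

lemma pathInvEccSum_odd (k : ℕ) :
    pathInvEccSum (2 * k + 1) = 2 * (realHarmonic (2 * k + 1) - realHarmonic k) := by
  have hsum : ∑ i ∈ range (k + 1), 1 / ((k + i : ℕ) + 1 : ℝ) =
      realHarmonic (2 * k + 1) - realHarmonic k := by
    have := Finset.sum_range_add (fun i : ℕ => 1 / ((i : ℝ) + 1)) k (k + 1)
    rw [realHarmonic, realHarmonic, show 2 * k + 1 = k + (k + 1) by ring, this]
    ring
  have h1 : ∑ i ∈ range (k + 1), 1 / ((max i (2 * k + 1 - i) : ℕ) : ℝ)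
      = ∑ i ∈ range (k + 1), 1 / ((k + i : ℕ) + 1 : ℝ) := by
    rw [← Finset.sum_range_reflect]
    refine sum_congr rfl fun i hi => ?_
    rw [mem_range] at hi
    rw [show max (k + 1 - 1 - i) (2 * k + 1 - (k + 1 - 1 - i)) = k + i + 1 by omega]
    push_cast; rfl
  have h2 : ∑ i ∈ range (k + 1), 1 / ((max (k + 1 + i) (2 * k + 1 - (k + 1 + i)) : ℕ) : ℝ)
      = ∑ i ∈ range (k + 1), 1 / ((k + i : ℕ) + 1 : ℝ) := by
    refine sum_congr rfl fun i hi => ?_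
    rw [mem_range] at hi
    rw [show max (k + 1 + i) (2 * k + 1 - (k + 1 + i)) = k + i + 1 by omega]
    push_cast; rfl
  rw [pathInvEccSum, show 2 * k + 1 + 1 = (k + 1) + (k + 1) by ring, Finset.sum_range_add, h1, h2,
    hsum]
  ring

lemma pathInvEccSum_even (k : ℕ) :
    pathInvEccSum (2 * k) = 1 / (k : ℝ) + 2 * (realHarmonic (2 * k) - realHarmonic k) := by
  have hsum : ∑ i ∈ range k, 1 / ((k + i : ℕ) + 1 : ℝ) = realHarmonic (2 * k) - realHarmonic k := by
    have := Finset.sum_range_add (fun i : ℕ => 1 / ((i : ℝ) + 1)) k k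
    rw [realHarmonic, realHarmonic, show 2 * k = k + k by ring, this]
    ring
  have h1 : ∑ i ∈ range k, 1 / ((max i (2 * k - i) : ℕ) : ℝ)
      = ∑ i ∈ range k, 1 / ((k + i : ℕ) + 1 : ℝ) := by
    rw [← Finset.sum_range_reflect]
    refine sum_congr rfl fun i hi => ?_
    rw [mem_range] at hi
    rw [show max (k - 1 - i) (2 * k - (k - 1 - i)) = k + i + 1 by omega]
    push_cast; rfl
  have h2 : ∑ i ∈ range k, 1 / ((max (k + 1 + i) (2 * k - (k + 1 + i)) : ℕ) : ℝ)
      = ∑ i ∈ range k, 1 / ((k + i : ℕ) + 1 : ℝ) := by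
    refine sum_congr rfl fun i hi => ?_
    rw [mem_range] at hi
    rw [show max (k + 1 + i) (2 * k - (k + 1 + i)) = k + i + 1 by omega]
    push_cast; rfl
  rw [pathInvEccSum, show 2 * k + 1 = (k + 1) + k by ring, Finset.sum_range_add,
    Finset.sum_range_succ, h1, h2, hsum, show max k (2 * k - k) = k by omega]
  ring

lemma pathInvEccSum_succ_le (d : ℕ) (hd : 1 ≤ d) :
    pathInvEccSum (d + 1) ≤ pathInvEccSum d := by
  have realHarmonic_succ (n : ℕ) : realHarmonic (n + 1) = realHarmonic n + 1 / ((n : ℝ) + 1) :=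
    sum_range_succ _ _
  obtain ⟨k, rfl | rfl⟩ := d.even_or_odd'
  · have hk : (0 : ℝ) < k := by norm_cast; omega
    rw [pathInvEccSum_odd, pathInvEccSum_even, realHarmonic_succ]
    have : 1 / (((2 * k : ℕ) : ℝ) + 1) ≤ 1 / (2 * k) := by
      push_cast
      exact one_div_le_one_div_of_le (by positivity) (by linarith)
    have h2 : 1 / (2 * (k : ℝ)) = 1 / k / 2 := by field_simp
    linarith
  · rw [show 2 * k + 1 + 1 = 2 * (k + 1) by ring, pathInvEccSum_odd, pathInvEccSum_even,
      show 2 * (k + 1) = 2 * k + 1 + 1 by ring, realHarmonic_succ (2 * k + 1), realHarmonic_succ k]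
    have : 1 / (((2 * k + 1 : ℕ) : ℝ) + 1) = 1 / ((k : ℝ) + 1) / 2 := by
      push_cast; field_simp; ring
    rw [this]; push_cast
    linarith

lemma pathIndex_eq (d : ℕ) (hd : 3 ≤ d) :
    pathIndex d = 4 * pathInvEccSum d - 4 / d - 4 / ((d : ℝ) - 1) := by
  have key : ∀ i ∈ range (d + 1), (pathWeight d i : ℝ) / (max i (d - i) : ℕ) =
      4 * (1 / ((max i (d - i) : ℕ) : ℝ)) - (if i = 0 then 2 / (d : ℝ) else 0)
        - (if i = 1 then 2 / ((d : ℝ) - 1) else 0) - (if i = d - 1 then 2 / ((d : ℝ) - 1) else 0)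
        - (if i = d then 2 / (d : ℝ) else 0) := by
    intro i hi
    rw [mem_range] at hi
    have hc : ((d - 1 : ℕ) : ℝ) = (d : ℝ) - 1 := by push_cast [show 1 ≤ d by omega]; rfl
    unfold pathWeight
    rcases eq_or_ne i 0 with rfl | h0
    · simp [show ¬ 0 = d - 1 by omega, show ¬ 0 = d by omega]; ring
    rcases eq_or_ne i 1 with rfl | h1
    · rw [show max 1 (d - 1) = d - 1 by omega, hc]
      simp [show ¬ 1 = d - 1 by omega, show ¬ 1 = d by omega]; ring
    rcases eq_or_ne i (d - 1) with rfl | h2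
    · rw [show max (d - 1) (d - (d - 1)) = d - 1 by omega, hc]
      simp [h0, h1, show ¬ d - 1 = d by omega, show d ≤ d - 1 + 1 by omega]; ring
    rcases eq_or_ne i d with rfl | h3
    · simp [h0, h1, h2]; ring
    rw [if_neg (by omega)]
    simp [h0, h1, h2, h3]; ring
  rw [pathIndex, sum_congr rfl key, sum_sub_distrib, sum_sub_distrib, sum_sub_distrib,
    sum_sub_distrib, ← mul_sum, ← pathInvEccSum]
  simp only [sum_ite_eq', mem_range]
  rw [if_pos (by omega), if_pos (by omega), if_pos (by omega), if_pos (by omega)]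
  ring

lemma pathIndex_succ_le (d : ℕ) (hd : 3 ≤ d) :
    pathIndex (d + 1) ≤ pathIndex d + 8 / (((d : ℝ) - 1) * (d + 1)) := by
  have hd' : (3 : ℝ) ≤ d := by exact_mod_cast hd
  rw [pathIndex_eq d hd, pathIndex_eq (d + 1) (by omega)]
  have h := pathInvEccSum_succ_le d (by omega)
  have e : 8 / (((d : ℝ) - 1) * (d + 1)) = 4 / ((d : ℝ) - 1) - 4 / ((d : ℝ) + 1) := by
    have : (d : ℝ) - 1 ≠ 0 := by linarith
    field_simp; ring
  rw [e]; push_cast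
  rw [add_sub_cancel_right]
  linarith

lemma pathIndex_add_lt (d m : ℕ) (hd : 3 ≤ d) :
    pathIndex (d + m) < pathIndex d + 2 * (m + 1) / d := by
  have hd' : (3 : ℝ) ≤ d := by exact_mod_cast hd
  have hpos : (0 : ℝ) < 2 / d := by positivity
  have e (x : ℝ) : 2 * (x + 1) / d = x * (2 / d) + 2 / d := by ring
  rw [e]
  rcases m with _ | m
  · simpa using hpos
  have h1 : pathIndex (d + 1) < pathIndex d + 2 * (2 / d) := by
    refine (pathIndex_succ_le d hd).trans_lt ?_
    gcongr
    rw [← mul_div_assoc, div_lt_div_iff₀ (by nlinarith) (by linarith)]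
    nlinarith
  induction m with
  | zero => push_cast; simpa [two_mul, add_assoc] using h1
  | succ m ih =>
    have h2 := pathIndex_succ_le (d + (m + 1)) (by omega)
    have h3 : 8 / (((d + (m + 1) : ℕ) - 1 : ℝ) * ((d + (m + 1) : ℕ) + 1)) ≤ 2 / d := by
      have hm : (0 : ℝ) ≤ m := by positivity
      push_cast
      rw [div_le_div_iff₀ (by nlinarith) (by linarith)]
      nlinarith [mul_nonneg hm hm, mul_nonneg hm (by linarith : (0 : ℝ) ≤ d)]
    push_cast at ih ⊢
    rw [← add_assoc d (m + 1) 1]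
    linarith

lemma pathIndex_three : pathIndex 3 = 10 / 3 := by
  norm_num [pathIndex, pathWeight, sum_range_succ]

section Basic

variable {V : Type*} [Fintype V] {G : SimpleGraph V}

open Classical in
lemma deg_eq_card (G : SimpleGraph V) (u : V) : deg G u = #{v | G.Adj u v} := by
  simp [deg, Set.ncard_eq_toFinset_card']

open Classical in
lemma Mprod_eq_prod (G : SimpleGraph V) (u : V) : Mprod G u = ∏ v with G.Adj u v, deg G v := by
  rw [Mprod, finprod_mem_eq_toFinset_prod, Set.toFinset_ofPred]

lemma card_le_deg {u : V} {s : Finset V} (hs : ∀ v ∈ s, G.Adj u v) : #s ≤ deg G u := by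
  classical
  rw [deg_eq_card]
  exact card_le_card fun v hv => by simpa using hs v hv

lemma one_le_deg {u v : V} (h : G.Adj u v) : 1 ≤ deg G u := by
  simpa using card_le_deg (s := {v}) (by simpa using h)

lemma prod_deg_le_Mprod {u : V} {s : Finset V} (hs : ∀ v ∈ s, G.Adj u v) :
    ∏ v ∈ s, deg G v ≤ Mprod G u := by
  classical
  rw [Mprod_eq_prod]
  refine prod_le_prod_of_subset_of_one_le' (fun v hv => by simpa using hs v hv) fun v hv _ => ?_
  simp only [mem_filter, mem_univ, true_and] at hv
  exact one_le_deg hv.symm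

lemma deg_le_Mprod {u v : V} (h : G.Adj u v) : deg G v ≤ Mprod G u := by
  simpa using prod_deg_le_Mprod (s := {v}) (by simpa using h)

lemma deg_mul_deg_le_Mprod {u v w : V} (hv : G.Adj u v) (hw : G.Adj u w) (hvw : v ≠ w) :
    deg G v * deg G w ≤ Mprod G u := by
  classical
  simpa [prod_pair hvw] using prod_deg_le_Mprod (s := {v, w}) (by simp [hv, hw])

lemma dist_le_ecc (u v : V) : G.dist u v ≤ ecc G u :=
  le_sup (f := fun v => G.dist u v) (mem_univ v)

lemma ecc_le {u : V} {k : ℕ} (h : ∀ v, G.dist u v ≤ k) : ecc G u ≤ k :=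
  Finset.sup_le fun v _ => h v

lemma ecc_pos (hG : G.Connected) {u v : V} (h : u ≠ v) : 0 < ecc G u :=
  (hG.pos_dist_of_ne h).trans_le (dist_le_ecc u v)

lemma div_le_Mprod_div_ecc (hG : G.Connected) [Nontrivial V] {u : V} {a : ℝ} {b : ℕ}
    (ha : a ≤ Mprod G u) (hb : ∀ v, G.dist u v ≤ b) :
    a / b ≤ (Mprod G u : ℝ) / ecc G u := by
  obtain ⟨v, hv⟩ := exists_ne u
  have := ecc_pos hG hv.symm
  have h2 : ecc G u ≤ b := ecc_le hb
  gcongr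

lemma two_le_Mprod (hG : G.Connected) {w x y : V} (hxy : 3 ≤ G.dist x y) : 2 ≤ Mprod G w := by
  classical
  have hz : ∃ z, 2 ≤ G.dist w z := by
    by_contra! h
    have h1 := hG.dist_triangle (u := x) (v := w) (w := y)
    have h2 := h x
    have h3 := h y
    rw [dist_comm] at h2
    omega
  obtain ⟨z, hz⟩ := hz
  obtain ⟨q, hq⟩ := hG.exists_walk_length_eq_dist w z
  cases q with
  | nil => simp at hz
  | @cons _ a _ hwa q =>
    cases q with
    | nil => rw [← hq] at hz; simp at hz
    | @cons _ b _ hab q =>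
      refine le_trans ?_ (deg_le_Mprod hwa)
      have hwb : w ≠ b := by
        rintro rfl
        have := dist_le q
        simp only [Walk.length_cons] at hq
        omega
      rw [← card_pair hwb]
      exact card_le_deg (by simp [hwa.symm, hab])

end Basic

section PathGraph

lemma val_le_dist_add_pathGraph {n : ℕ} (i j : Fin n) :
    (i : ℕ) ≤ j + (pathGraph n).dist i j := by
  obtain ⟨q, hq⟩ := (pathGraph_preconnected n i j).exists_walk_length_eq_dist
  rw [← hq]
  clear hq
  induction q with
  | nil => simp
  | cons h q ih =>
    rw [pathGraph_adj] at h
    rw [Walk.length_cons]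
    omega

lemma max_le_ecc_pathGraph {d : ℕ} (i : Fin (d + 1)) :
    max (i : ℕ) (d - i) ≤ ecc (pathGraph (d + 1)) i := by
  have h0 := val_le_dist_add_pathGraph i 0
  have hl := val_le_dist_add_pathGraph (Fin.last d) i
  have h0' := dist_le_ecc (G := pathGraph (d + 1)) i 0
  have hl' := dist_le_ecc (G := pathGraph (d + 1)) i (Fin.last d)
  rw [dist_comm] at hl
  simp only [Fin.val_zero, Fin.val_last] at *
  omega

lemma deg_pathGraph_le_two {n : ℕ} (i : Fin n) : deg (pathGraph n) i ≤ 2 := by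
  classical
  rw [deg_eq_card, ← card_map Fin.valEmbedding]
  refine (card_le_card (t := {(i : ℕ) - 1, (i : ℕ) + 1}) fun x hx => ?_).trans card_le_two
  simp only [mem_map, mem_filter, mem_univ, true_and, pathGraph_adj, Fin.valEmbedding_apply] at hx
  obtain ⟨y, hy, rfl⟩ := hx
  simp only [mem_insert, mem_singleton]
  omega

lemma deg_pathGraph_le_one {d : ℕ} (i : Fin (d + 1)) (hi : (i : ℕ) = 0 ∨ (i : ℕ) = d) :
    deg (pathGraph (d + 1)) i ≤ 1 := by
  classical
  rw [deg_eq_card, card_le_one]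
  intro a ha b hb
  simp only [mem_filter, mem_univ, true_and, pathGraph_adj] at ha hb
  ext
  omega

lemma Mprod_pathGraph_le {d : ℕ} (i : Fin (d + 1)) :
    Mprod (pathGraph (d + 1)) i ≤ pathWeight d i := by
  classical
  set s : Finset (Fin (d + 1)) := {v | (pathGraph (d + 1)).Adj i v}
  set t := s.filter fun v : Fin (d + 1) => (v : ℕ) ≠ 0 ∧ (v : ℕ) ≠ d
  have h : Mprod (pathGraph (d + 1)) i ≤ 2 ^ #t := by
    rw [Mprod_eq_prod, ← prod_const, prod_filter (s := s)]
    refine prod_le_prod' fun v _ => ?_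
    split_ifs with hv
    · exact deg_pathGraph_le_two v
    · exact deg_pathGraph_le_one v (by tauto)
  unfold pathWeight
  split_ifs with hi
  · have : #t ≤ 1 := by
      rw [card_le_one]
      intro a ha b hb
      simp only [t, s, mem_filter, mem_univ, true_and, pathGraph_adj] at ha hb
      ext
      omega
    exact h.trans (Nat.pow_le_pow_right two_pos this)
  · have : #t ≤ 2 := (card_le_card (filter_subset _ _)).trans
      (by simpa [deg_eq_card] using deg_pathGraph_le_two i)
    exact h.trans (Nat.pow_le_pow_right two_pos this)

lemma xiAC_pathGraph_le {d : ℕ} (hd : 1 ≤ d) : xiAC (pathGraph (d + 1)) ≤ pathIndex d := by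
  rw [xiAC, pathIndex, ← Fin.sum_univ_eq_sum_range
    (fun i => (pathWeight d i : ℝ) / (max i (d - i) : ℕ))]
  refine sum_le_sum fun i _ => ?_
  have h1 := Mprod_pathGraph_le i
  have h2 := max_le_ecc_pathGraph i
  have h3 : 0 < max (i : ℕ) (d - i) := by omega
  gcongr

end PathGraph

section Tree

variable {V : Type*} {T : SimpleGraph V}

lemma SimpleGraph.IsTree.eq_of_dist_eq_add_one (hT : T.IsTree) {w v a b : V} (ha : T.Adj a v)
    (hb : T.Adj b v) (hwa : T.dist w v = T.dist w a + 1) (hwb : T.dist w v = T.dist w b + 1) :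
    a = b := by
  obtain ⟨p, hp⟩ := hT.1.exists_walk_length_eq_dist w a
  obtain ⟨q, hq⟩ := hT.1.exists_walk_length_eq_dist w b
  have hp' := (p.concat ha).isPath_of_length_eq_dist (by rw [Walk.length_concat, hp, hwa])
  have hq' := (q.concat hb).isPath_of_length_eq_dist (by rw [Walk.length_concat, hq, hwb])
  obtain ⟨h, -⟩ := Walk.concat_inj ((hT.existsUnique_path w v).unique hp' hq')
  exact h

/-- `p 0, …, p d` is a shortest path joining two vertices at maximum distance. -/
structure IsDiametralPath (T : SimpleGraph V) (p : ℕ → V) (d : ℕ) : Prop where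
  adj : ∀ i < d, T.Adj (p i) (p (i + 1))
  dist_ends : T.dist (p 0) (p d) = d
  dist_le : ∀ x y, T.dist x y ≤ d

lemma exists_isDiametralPath [Fintype V] (hT : T.Connected) :
    ∃ p d, IsDiametralPath T p d := by
  have := hT.nonempty
  obtain ⟨⟨x, y⟩, h⟩ := Finite.exists_max fun z : V × V => T.dist z.1 z.2
  obtain ⟨q, hq⟩ := hT.exists_walk_length_eq_dist x y
  refine ⟨q.getVert, T.dist x y, fun i hi => q.adj_getVert_succ (hq ▸ hi), ?_, fun a b => h (a, b)⟩
  rw [← hq, Walk.getVert_zero, Walk.getVert_length, hq]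

namespace IsDiametralPath

variable {p : ℕ → V} {d : ℕ}

lemma dist_le_sub (h : IsDiametralPath T p d) (hT : T.Connected) {i j : ℕ} (hij : i ≤ j)
    (hj : j ≤ d) : T.dist (p i) (p j) ≤ j - i := by
  induction j, hij using Nat.le_induction with
  | base => simp
  | succ j hij ih =>
    have h1 := hT.dist_triangle (u := p i) (v := p j) (w := p (j + 1))
    have h2 := dist_eq_one_iff_adj.2 (h.adj j hj)
    have h3 := ih (by omega)
    omega

lemma dist_eq (h : IsDiametralPath T p d) (hT : T.Connected) {i j : ℕ} (hij : i ≤ j)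
    (hj : j ≤ d) : T.dist (p i) (p j) = j - i := by
  have h1 := h.dist_le_sub hT (Nat.zero_le i) (hij.trans hj)
  have h2 := h.dist_le_sub hT hij hj
  have h3 := h.dist_le_sub hT hj le_rfl
  have h4 := hT.dist_triangle (u := p 0) (v := p i) (w := p d)
  have h5 := hT.dist_triangle (u := p i) (v := p j) (w := p d)
  have h6 := h.dist_ends
  omega

lemma injOn (h : IsDiametralPath T p d) (hT : T.Connected) :
    Set.InjOn p (range (d + 1) : Finset ℕ) := by
  intro i hi j hj hij
  simp only [coe_range, Set.mem_Iio] at hi hj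
  wlog hle : i ≤ j generalizing i j
  · exact (this hij.symm hj hi (by omega)).symm
  have := h.dist_eq hT hle (by omega)
  rw [hij, dist_self] at this
  omega

lemma adj_iff (h : IsDiametralPath T p d) (hT : T.Connected) {i j : ℕ} (hi : i ≤ d)
    (hj : j ≤ d) : T.Adj (p i) (p j) ↔ i + 1 = j ∨ j + 1 = i := by
  rw [← dist_eq_one_iff_adj]
  rcases le_total i j with hij | hij
  · rw [h.dist_eq hT hij hj]; omega
  · rw [dist_comm, h.dist_eq hT hij hi]; omega

lemma dist_succ (h : IsDiametralPath T p d) (hT : T.IsTree) (w : V) {i : ℕ} (hi : i < d) :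
    T.dist w (p (i + 1)) = T.dist w (p i) + 1 ∨ T.dist w (p i) = T.dist w (p (i + 1)) + 1 :=
  (hT.dist_eq_dist_add_one_of_adj w (h.adj i hi)).symm

lemma dist_succ_of_dist_succ (h : IsDiametralPath T p d) (hT : T.IsTree) {w : V} {i : ℕ}
    (hi : i + 1 < d) (hw : T.dist w (p (i + 1)) = T.dist w (p i) + 1) :
    T.dist w (p (i + 1 + 1)) = T.dist w (p (i + 1)) + 1 := by
  refine (h.dist_succ hT w hi).resolve_right fun h2 => ?_
  have h3 := hT.eq_of_dist_eq_add_one (h.adj i (by omega)) (h.adj (i + 1) hi).symm hw h2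
  have := h.injOn hT.1 (by simp; omega) (by simp; omega) h3
  omega

lemma dist_of_dist_succ (h : IsDiametralPath T p d) (hT : T.IsTree) {w : V} {i k : ℕ}
    (hw : T.dist w (p (i + 1)) = T.dist w (p i) + 1) (hik : i ≤ k) (hk : k < d) :
    T.dist w (p (k + 1)) = T.dist w (p k) + 1 ∧
      T.dist w (p (k + 1)) = T.dist w (p i) + (k + 1 - i) := by
  induction k, hik using Nat.le_induction with
  | base => exact ⟨hw, by omega⟩
  | succ k hik ih =>
    have h1 := ih (by omega)
    have h2 := h.dist_succ_of_dist_succ hT hk h1.1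
    exact ⟨h2, by omega⟩

lemma dist_of_dist_pred (h : IsDiametralPath T p d) (hT : T.IsTree) {w : V} {i : ℕ} (hi : i < d)
    (hw : T.dist w (p i) = T.dist w (p (i + 1)) + 1) :
    T.dist w (p 0) = T.dist w (p i) + i := by
  have key : ∀ k ≤ i, T.dist w (p 0) = T.dist w (p k) + k := by
    intro k
    induction k with
    | zero => simp
    | succ k ih =>
      intro hk
      have h1 := ih (by omega)
      rcases h.dist_succ hT w (show k < d by omega) with h2 | h2
      · have := (h.dist_of_dist_succ hT h2 (by omega : k ≤ i) hi).1
        omega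
      · omega
  exact key i le_rfl

lemma dist_le_max (h : IsDiametralPath T p d) (hT : T.IsTree) (w : V) {i : ℕ} (hi : i ≤ d) :
    T.dist w (p i) ≤ max i (d - i) := by
  have h0 := h.dist_le w (p 0)
  have hd := h.dist_le w (p d)
  rcases hi.eq_or_lt with rfl | hi
  · omega
  rcases h.dist_succ hT w hi with h1 | h1
  · have := (h.dist_of_dist_succ hT h1 (by omega : i ≤ d - 1) (by omega)).2
    rw [Nat.sub_add_cancel (by omega)] at this
    omega
  · have := h.dist_of_dist_pred hT hi h1
    omega

lemma nonempty_iso_pathGraph (h : IsDiametralPath T p d) (hT : T.Connected)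
    (hp : ∀ x, ∃ i ≤ d, p i = x) : Nonempty (T ≃g pathGraph (d + 1)) := by
  have hbij : Function.Bijective fun i : Fin (d + 1) => p i := by
    refine ⟨fun i j hij => Fin.ext (h.injOn hT (by simp; omega) (by simp; omega) hij), fun x => ?_⟩
    obtain ⟨i, hi, rfl⟩ := hp x
    exact ⟨⟨i, by omega⟩, rfl⟩
  have e : pathGraph (d + 1) ≃g T :=
    { toEquiv := Equiv.ofBijective _ hbij
      map_rel_iff' := by
        intro a b
        simp only [Equiv.ofBijective_apply]
        rw [h.adj_iff hT (by omega) (by omega), pathGraph_adj] }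
  exact ⟨e.symm⟩

lemma exists_adj_not_mem (h : IsDiametralPath T p d) (hT : T.IsTree)
    (hp : ¬ ∀ x, ∃ i ≤ d, p i = x) :
    ∃ u j, 0 < j ∧ j < d ∧ T.Adj (p j) u ∧ ∀ i ≤ d, p i ≠ u := by
  push Not at hp
  obtain ⟨x, hx⟩ := hp
  obtain ⟨q⟩ := hT.1.preconnected (p 0) x
  obtain ⟨e, -, ⟨j, hj, hje⟩, he⟩ := q.exists_boundary_dart {y | ∃ i ≤ d, p i = y}
    ⟨0, by omega, rfl⟩ (by rintro ⟨i, hi, hix⟩; exact hx i hi hix)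
  have hu : ∀ i ≤ d, p i ≠ e.snd := fun i hi hiu => he ⟨i, hi, hiu⟩
  have hju : T.Adj (p j) e.snd := hje ▸ e.adj
  have h1 : T.dist e.snd (p j) = 1 := dist_eq_one_iff_adj.2 hju.symm
  have hpos (i : ℕ) (hi : i ≤ d) : 0 < T.dist e.snd (p i) := hT.1.pos_dist_of_ne (hu i hi).symm
  have hd := h.dist_le e.snd (p d)
  have h0 := h.dist_le e.snd (p 0)
  have hd0 := hpos d le_rfl
  refine ⟨e.snd, j, ?_, ?_, hju, hu⟩
  · rw [pos_iff_ne_zero]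
    rintro rfl
    rcases h.dist_succ hT e.snd (i := 0) (by omega) with h2 | h2
    · have := (h.dist_of_dist_succ hT h2 (by omega : 0 ≤ d - 1) (by omega)).2
      rw [Nat.sub_add_cancel (by omega)] at this
      omega
    · have := hpos (0 + 1) (by omega)
      omega
  · by_contra hjd
    obtain rfl : j = d := by omega
    have hsub : j - 1 + 1 = j := by omega
    have h3 := hpos (j - 1) (by omega)
    have h2 := h.dist_succ hT e.snd (i := j - 1) (by omega)
    rw [hsub] at h2
    have := h.dist_of_dist_pred hT (i := j - 1) (w := e.snd) (by omega) (by rw [hsub]; omega)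
    omega

section Fintype

variable [Fintype V] {u : V} {j : ℕ}

lemma one_le_deg (h : IsDiametralPath T p d) (hd : 0 < d) {i : ℕ} (hi : i ≤ d) :
    1 ≤ deg T (p i) := by
  rcases hi.eq_or_lt with rfl | hi
  · have := h.adj (i - 1) (by omega)
    rw [Nat.sub_add_cancel (by omega)] at this
    exact _root_.one_le_deg this.symm
  · exact _root_.one_le_deg (h.adj i hi)

lemma two_le_deg (h : IsDiametralPath T p d) (hT : T.Connected) {i : ℕ} (h0 : 0 < i)
    (hd : i < d) : 2 ≤ deg T (p i) := by
  classical
  have hne : p (i - 1) ≠ p (i + 1) := fun he => by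
    have := h.injOn hT (by simp; omega) (by simp; omega) he
    omega
  rw [← card_pair hne]
  refine card_le_deg ?_
  simp only [mem_insert, mem_singleton, forall_eq_or_imp, forall_eq]
  rw [h.adj_iff hT (by omega) (by omega), h.adj_iff hT (by omega) (by omega)]
  omega

lemma three_le_deg (h : IsDiametralPath T p d) (hT : T.Connected) (h0 : 0 < j)
    (hd : j < d) (hju : T.Adj (p j) u) (hu : ∀ i ≤ d, p i ≠ u) : 3 ≤ deg T (p j) := by
  classical
  have hne : p (j - 1) ≠ p (j + 1) := fun he => by
    have := h.injOn hT (by simp; omega) (by simp; omega) he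
    omega
  have hcard : #{u, p (j - 1), p (j + 1)} = 3 := by
    rw [card_insert_of_notMem, card_pair hne]
    simp only [mem_insert, mem_singleton, not_or]
    exact ⟨(hu _ (by omega)).symm, (hu _ (by omega)).symm⟩
  rw [← hcard]
  refine card_le_deg ?_
  simp only [mem_insert, mem_singleton, forall_eq_or_imp, forall_eq]
  rw [h.adj_iff hT (by omega) (by omega), h.adj_iff hT (by omega) (by omega)]
  exact ⟨hju, by omega, by omega⟩

lemma pathWeight_add_le_Mprod (h : IsDiametralPath T p d) (hT : T.Connected) (h3 : 3 ≤ d)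
    (h0 : 0 < j) (hd : j < d) (hju : T.Adj (p j) u) (hu : ∀ i ≤ d, p i ≠ u) {i : ℕ} (hi : i ≤ d) :
    pathWeight d i + (if i = j - 1 then 1 else 0) + (if i = j + 1 then 1 else 0)
      ≤ Mprod T (p i) := by
  have hj := h.three_le_deg hT h0 hd hju hu
  have hdeg {k : ℕ} (hk0 : 0 < k) (hkd : k < d) : 2 + (if k = j then 1 else 0) ≤ deg T (p k) := by
    split_ifs with hk
    · rwa [hk]
    · exact h.two_le_deg hT hk0 hkd
  have hsucc (hi : i < d) : T.Adj (p i) (p (i + 1)) := h.adj i hi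
  have hpred (hi0 : 0 < i) : T.Adj (p i) (p (i - 1)) := by
    rw [h.adj_iff hT hi (by omega)]; omega
  rcases Nat.eq_zero_or_pos i with rfl | hi0
  · have hw : pathWeight d 0 = 2 := if_pos (by omega)
    have h1 := deg_le_Mprod (hsucc (by omega))
    have h2 := hdeg (k := 0 + 1) (by omega) (by omega)
    rw [if_neg (show ¬ 0 = j + 1 by omega)]
    split_ifs at h2 ⊢ <;> omega
  rcases hi.eq_or_lt with rfl | hid
  · have hw : pathWeight i i = 2 := if_pos (by omega)
    have h1 := deg_le_Mprod (hpred hi0)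
    have h2 := hdeg (k := i - 1) (by omega) (by omega)
    split_ifs at h2 ⊢ <;> omega
  have hne : p (i - 1) ≠ p (i + 1) := fun he => by
    have := h.injOn hT (by simp; omega) (by simp; omega) he
    omega
  have hM := deg_mul_deg_le_Mprod (hpred hi0) (hsucc hid) hne
  refine le_trans ?_ hM
  have hl := h.one_le_deg (by omega) (show i - 1 ≤ d by omega)
  have hr := h.one_le_deg (by omega) (show i + 1 ≤ d by omega)
  rcases eq_or_ne i 1 with rfl | hi1
  · have hw : pathWeight d 1 = 2 := if_pos (by omega)
    have h2 := hdeg (k := 1 + 1) (by omega) (by omega)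
    refine le_trans ?_ (Nat.le_mul_of_pos_left _ hl)
    split_ifs at h2 ⊢ <;> omega
  rcases eq_or_ne (i + 1) d with hi2 | hi2
  · have hw : pathWeight d i = 2 := if_pos (by omega)
    have h2 := hdeg (k := i - 1) (by omega) (by omega)
    refine le_trans ?_ (Nat.le_mul_of_pos_right _ hr)
    split_ifs at h2 ⊢ <;> omega
  have hw : pathWeight d i = 4 := if_neg (by omega)
  have h1 := hdeg (k := i - 1) (by omega) (by omega)
  have h2 := hdeg (k := i + 1) (by omega) (by omega)
  refine le_trans ?_ (Nat.mul_le_mul h1 h2)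
  split_ifs <;> omega

lemma le_xiAC (h : IsDiametralPath T p d) (hT : T.IsTree) (h3 : 3 ≤ d)
    (h0 : 0 < j) (hd : j < d) (hju : T.Adj (p j) u) (hu : ∀ i ≤ d, p i ≠ u) {m : ℕ}
    (hm : Fintype.card V = d + m + 1) :
    pathIndex d + 2 * (m + 1) / d ≤ xiAC T := by
  classical
  have : Nontrivial V := ⟨⟨p j, u, hju.ne⟩⟩
  have hd0 : (0 : ℝ) < d := by norm_cast; omega
  set s := (range (d + 1)).image p
  have hscard : #s = d + 1 := by rw [card_image_of_injOn (h.injOn hT.1), card_range]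
  have hcompl : #sᶜ = m := by rw [card_compl, hscard, hm]; omega
  have hout : m * (2 / (d : ℝ)) ≤ ∑ w ∈ sᶜ, (Mprod T w : ℝ) / ecc T w := by
    rw [← hcompl, ← nsmul_eq_mul]
    refine card_nsmul_le_sum _ _ _ fun w _ => div_le_Mprod_div_ecc hT.1 ?_ (h.dist_le w)
    exact_mod_cast two_le_Mprod hT.1 (h.dist_ends.symm ▸ h3)
  have hin : pathIndex d + 1 / (d : ℝ) + 1 / d ≤ ∑ w ∈ s, (Mprod T w : ℝ) / ecc T w := by
    rw [sum_image (h.injOn hT.1)]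
    have hsingle (k : ℕ) (hk : k ≤ d) :
        1 / (d : ℝ) = ∑ i ∈ range (d + 1), if i = k then 1 / (d : ℝ) else 0 := by
      rw [sum_ite_eq', if_pos (by simp; omega)]
    refine (congrArg₂ _ (congrArg₂ _ rfl (hsingle (j - 1) (by omega)))
      (hsingle (j + 1) (by omega))).trans_le ?_
    rw [pathIndex, ← sum_add_distrib, ← sum_add_distrib]
    refine sum_le_sum fun i hi => ?_
    rw [mem_range] at hi
    have hM := h.pathWeight_add_le_Mprod hT.1 h3 h0 hd hju hu (i := i) (by omega)
    have hmax : ((max i (d - i) : ℕ) : ℝ) ≤ d := by norm_cast; omega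
    have hmax0 : (0 : ℝ) < (max i (d - i) : ℕ) := by norm_cast; omega
    have hone : 1 / (d : ℝ) ≤ 1 / (max i (d - i) : ℕ) := one_div_le_one_div_of_le hmax0 hmax
    refine le_trans ?_ (div_le_Mprod_div_ecc hT.1 (Nat.cast_le.2 hM) fun v =>
      (dist_comm (G := T)).trans_le (h.dist_le_max hT v (by omega)))
    push_cast
    rw [add_div, add_div]
    gcongr <;> split_ifs <;> simp_all
  rw [xiAC, ← sum_add_sum_compl s]
  have : 2 * ((m : ℝ) + 1) / d = m * (2 / d) + (1 / d + 1 / d) := by ring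
  linarith

lemma le_xiAC_of_two (h : IsDiametralPath T p 2) (hT : T.IsTree) {m : ℕ}
    (hm : Fintype.card V = m + 1) : (m : ℝ) ^ 2 / 2 ≤ xiAC T := by
  classical
  have : Nontrivial V := ⟨⟨p 0, p 1, (h.adj 0 (by omega)).ne⟩⟩
  have hadj (w : V) (hw : w ≠ p 1) : T.Adj w (p 1) := by
    rw [← dist_eq_one_iff_adj]
    have h1 := h.dist_le_max hT w (show 1 ≤ 2 by omega)
    have h2 := hT.1.pos_dist_of_ne hw
    omega
  have hcard : #(univ.erase (p 1)) = m := by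
    rw [card_erase_of_mem (mem_univ _), card_univ, hm, Nat.add_sub_cancel]
  have hdeg : m ≤ deg T (p 1) := by
    rw [← hcard]
    exact card_le_deg fun v hv => (hadj v (ne_of_mem_erase hv)).symm
  calc (m : ℝ) ^ 2 / 2 = #(univ.erase (p 1)) • ((m : ℝ) / (2 : ℕ)) := by
        rw [hcard, nsmul_eq_mul]; push_cast; ring
    _ ≤ ∑ w ∈ univ.erase (p 1), (Mprod T w : ℝ) / ecc T w := by
        refine card_nsmul_le_sum _ _ _ fun w hw => div_le_Mprod_div_ecc hT.1 ?_ (h.dist_le w)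
        exact_mod_cast hdeg.trans (deg_le_Mprod (hadj w (ne_of_mem_erase hw)))
    _ ≤ xiAC T := sum_le_sum_of_subset_of_nonneg (subset_univ _) fun _ _ _ => by positivity

end Fintype

end IsDiametralPath

end Tree

/-- Let `T ≠ P_n` be a tree on `n` vertices. Then `ξ^{ac}(T) > ξ^{ac}(P_n)`. -/
theorem xiAC_tree_gt_path (n : ℕ) {V : Type*} [Fintype V] (T : SimpleGraph V)
    (hT : T.IsTree) (hn : Fintype.card V = n)
    (hnotpath : ¬ Nonempty (T ≃g pathGraph n)) :
    xiAC (pathGraph n) < xiAC T := by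
  classical
  obtain ⟨p, d, h⟩ := exists_isDiametralPath hT.1
  have hscard : #((range (d + 1)).image p) = d + 1 := by
    rw [card_image_of_injOn (h.injOn hT.1), card_range]
  have hp : ¬ ∀ x, ∃ i ≤ d, p i = x := by
    intro hp
    have hs : (range (d + 1)).image p = univ := by
      ext x
      simpa [Nat.lt_succ_iff] using hp x
    rw [hs, card_univ, hn] at hscard
    exact hnotpath (hscard ▸ h.nonempty_iso_pathGraph hT.1 hp)
  obtain ⟨u, j, h0, hjd, hju, hu⟩ := h.exists_adj_not_mem hT hp
  have hlt : d + 1 < n := by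
    rw [← hscard, ← hn]
    refine card_lt_univ_of_notMem (x := u) ?_
    simpa [Nat.lt_succ_iff] using hu
  rcases (show 2 ≤ d by omega).eq_or_lt with rfl | h3
  · obtain ⟨m, rfl⟩ : ∃ m, n = 3 + m + 1 := ⟨n - 4, by omega⟩
    have h1 := xiAC_pathGraph_le (d := 3 + m) (by omega)
    have h2 := pathIndex_add_lt 3 m le_rfl
    have h4 := h.le_xiAC_of_two hT hn
    rw [pathIndex_three] at h2
    push_cast at h2 h4
    nlinarith [sq_nonneg (m : ℝ), m.cast_nonneg (α := ℝ)]
  · obtain ⟨m, rfl⟩ : ∃ m, n = d + m + 1 := ⟨n - (d + 1), by omega⟩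
    exact (xiAC_pathGraph_le (by omega)).trans_lt ((pathIndex_add_lt d m h3).trans_le
      (h.le_xiAC hT h3 h0 hjd hju hu hn))
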